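/- The assignment sending an indecomposable τ-rigid module N to the unique brick S with Fac N = ⟨S⟩_tors induces a bijection from the set of isomorphism classes of indecomposable τ-rigid modules in mod A onto the set of isomorphism classes of left finite bricks in mod A. -/

import Mathlib

/-! Common definitions: finite-dimensional modules over a finite-dimensional algebra,
quotient modules, dimension vectors via composition series, Newton polytopes,
torsion classes, `Fac`, τ-rigidity, bricks, etc. -/

variable (A : Type) [Ring A]

/-- `X` is a quotient module of `M`. -/
def IsQuotientOf (M X : ModuleCat.{0} A) : Prop :=
  ∃ f : M →ₗ[A] X, Function.Surjective f

open Classical in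
/-- The dimension vector of a module `M`, relative to a family `S : Fin n → ModuleCat A`
of (representatives of the isomorphism classes of the) simple `A`-modules: its `i`-th entry
is the multiplicity of `S i` as a composition factor of `M` (well defined by Jordan–Hölder,
for `M` of finite length). -/
noncomputable def dimVec {n : ℕ} (S : Fin n → ModuleCat.{0} A)
    (M : Type) [AddCommGroup M] [Module A M] : Fin n → ℕ := fun i =>
  if h : ∃ s : CompositionSeries (Submodule A M),
      RelSeries.head s = ⊥ ∧ RelSeries.last s = ⊤ then
    Nat.card {j : Fin h.choose.length //
      Nonempty ((↥(h.choose j.succ) ⧸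
        (Submodule.comap (h.choose j.succ).subtype
          (h.choose j.castSucc))) ≃ₗ[A] S i)}
  else 0

/-- The Newton polytope of `U`: the convex hull in `ℝⁿ` of the dimension vectors of
the quotient modules of `U`. -/
noncomputable def newtonPolytope {n : ℕ} (S : Fin n → ModuleCat.{0} A)
    (U : ModuleCat.{0} A) : Set (Fin n → ℝ) :=
  convexHull ℝ { v : Fin n → ℝ | ∃ p : Submodule A U,
    v = fun i => ((dimVec A S (↥U ⧸ p) i : ℕ) : ℝ) }

/-- `Fac M`: the class of quotient modules of finite direct sums of copies of `M`. -/
def Fac (M : ModuleCat.{0} A) : Set (ModuleCat.{0} A) :=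
  { X | ∃ (k : ℕ) (f : (Fin k → M) →ₗ[A] X), Function.Surjective f }

/-- A torsion class in `mod A`: a class of finite-dimensional `A`-modules closed under
isomorphisms, quotient modules and extensions. -/
def IsTorsionClass (T : Set (ModuleCat.{0} A)) : Prop :=
  (∀ M ∈ T, Module.Finite A M) ∧
  (∀ M ∈ T, ∀ N : ModuleCat.{0} A, Nonempty (M ≃ₗ[A] N) → N ∈ T) ∧
  (∀ M ∈ T, ∀ X : ModuleCat.{0} A, IsQuotientOf A M X → X ∈ T) ∧
  (∀ (L E N : ModuleCat.{0} A) (f : L →ₗ[A] E) (g : E →ₗ[A] N),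
    Function.Injective f → Function.Surjective g →
    LinearMap.range f = LinearMap.ker g → L ∈ T → N ∈ T → E ∈ T)

/-- `⟨N⟩_tors`, the smallest torsion class containing `N`. -/
def torsGen (N : ModuleCat.{0} A) : Set (ModuleCat.{0} A) :=
  ⋂₀ { T | IsTorsionClass A T ∧ N ∈ T }

/-- A module `N` is left finite if the torsion class it generates is functorially finite,
i.e. `⟨N⟩_tors = Fac M` for some `M` in `mod A`. -/
def LeftFinite (N : ModuleCat.{0} A) : Prop :=
  ∃ M : ModuleCat.{0} A, Module.Finite A M ∧ torsGen A N = Fac A M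

/-- `M` is τ-rigid: `Ext¹(M, X) = 0` for every `X ∈ Fac M`, expressed by the splitting of
every short exact sequence `0 → X → E → M → 0`. -/
def IsTauRigid (M : ModuleCat.{0} A) : Prop :=
  ∀ X ∈ Fac A M, ∀ (E : ModuleCat.{0} A) (f : X →ₗ[A] E) (g : E →ₗ[A] M),
    Function.Injective f → Function.Surjective g → LinearMap.range f = LinearMap.ker g →
    ∃ s : M →ₗ[A] E, g.comp s = LinearMap.id

/-- `M` is indecomposable. -/
def Indecomposable (M : ModuleCat.{0} A) : Prop :=
  Nontrivial M ∧ ∀ (M₁ M₂ : ModuleCat.{0} A),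
    Nonempty (M ≃ₗ[A] (M₁ × M₂)) → (Subsingleton M₁ ∨ Subsingleton M₂)

/-- `M` is a brick: its endomorphism ring is a division ring, i.e. `M ≠ 0` and every
nonzero endomorphism of `M` is invertible. -/
def IsBrick (M : ModuleCat.{0} A) : Prop :=
  Nontrivial M ∧ ∀ f : M →ₗ[A] M, f ≠ 0 → Function.Bijective f

/-- The setoid identifying isomorphic modules, restricted to modules satisfying `P`. -/
def isoSetoid (P : ModuleCat.{0} A → Prop) : Setoid {M : ModuleCat.{0} A // P M} where
  r M N := Nonempty (M.1 ≃ₗ[A] N.1)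
  iseqv := ⟨fun M => ⟨LinearEquiv.refl A M.1⟩, fun ⟨e⟩ => ⟨e.symm⟩,
    fun ⟨e⟩ ⟨f⟩ => ⟨e.trans f⟩⟩

section TauRigidBricks

variable {A}

section Fitting

variable {N : Type} [AddCommGroup N] [Module A N]

/-- An indecomposable module `N` satisfies Fitting's alternative. -/
theorem Indecomposable.bijective_or_isNilpotent [IsNoetherian A N] [IsArtinian A N]
    (hN : Indecomposable A (ModuleCat.of A N)) (f : Module.End A N) :
    Function.Bijective f ∨ IsNilpotent f := by
  obtain ⟨n, hn⟩ := Filter.eventually_atTop.mp f.eventually_isCompl_ker_pow_range_pow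
  have hc := hn (n + 1) (Nat.le_succ n)
  rcases hN.2 (ModuleCat.of A (LinearMap.ker (f ^ (n + 1))))
    (ModuleCat.of A (LinearMap.range (f ^ (n + 1))))
    ⟨(Submodule.prodEquivOfIsCompl _ _ hc).symm⟩ with h | h
  · left
    have hk : LinearMap.ker (f ^ (n + 1)) = ⊥ := Submodule.subsingleton_iff_eq_bot.mp h
    have hf : Function.Injective f := by
      rw [LinearMap.ker_eq_bot] at hk
      rw [pow_succ, Module.End.coe_mul] at hk
      exact hk.of_comp
    exact IsArtinian.bijective_of_injective_endomorphism f hf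
  · right
    have hr : LinearMap.range (f ^ (n + 1)) = ⊥ := Submodule.subsingleton_iff_eq_bot.mp h
    exact ⟨n + 1, LinearMap.range_eq_bot.mp hr⟩

theorem isArtinianRing_end_of_finite
    (K : Type) [Field K] [Algebra K A] [FiniteDimensional K A]
    [Module.Finite A N] : IsArtinianRing (Module.End A N) := by
  let : Module K N := Module.compHom N (algebraMap K A)
  have : IsScalarTower K A N := ⟨fun k a n => by
    rw [Algebra.smul_def, mul_smul]; rfl⟩
  have : SMulCommClass A K N := ⟨fun a k n => by
    change a • (algebraMap K A k) • n = (algebraMap K A k) • a • n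
    rw [← mul_smul, ← mul_smul, Algebra.commutes]⟩
  have : SMulCommClass K A N := SMulCommClass.symm A K N
  have : Module.Finite K N := Module.Finite.trans A N
  have : Module.Finite K (Module.End A N) :=
    Module.Finite.of_injective (LinearMap.restrictScalarsₗ K A N N K)
      (LinearMap.restrictScalars_injective K)
  exact isArtinian_of_tower K inferInstance

/-- Products of sufficiently many non-isomorphisms of an indecomposable module vanish. -/
theorem Indecomposable.exists_prod_eq_zero
    (K : Type) [Field K] [Algebra K A] [FiniteDimensional K A] [Module.Finite A N]
    (hN : Indecomposable A (ModuleCat.of A N)) :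
    ∃ n : ℕ, ∀ l : List (Module.End A N), l.length = n →
      (∀ f ∈ l, ¬ Function.Bijective f) → l.prod = 0 := by
  have : IsArtinianRing A := isArtinian_of_tower K inferInstance
  have := isArtinianRing_end_of_finite (A := A) (N := N) K
  obtain ⟨n, hn⟩ := IsSemiprimaryRing.isNilpotent (R := Module.End A N)
  have hJ : ∀ f : Module.End A N, ¬ Function.Bijective f → f ∈ Ring.jacobson (Module.End A N) := by
    intro f hf
    rw [← Ideal.jacobson_bot, Ideal.mem_jacobson_iff]
    intro g
    have hgf : ¬ Function.Bijective (g * f) := fun h =>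
      hf (IsArtinian.bijective_of_injective_endomorphism f
        (by rw [Module.End.coe_mul] at h; exact h.1.of_comp))
    have hnil := (hN.bijective_or_isNilpotent (g * f)).resolve_left hgf
    obtain ⟨u, hu⟩ := hnil.isUnit_add_one
    refine ⟨(u⁻¹ : (Module.End A N)ˣ), ?_⟩
    have : (↑u⁻¹ : Module.End A N) * (g * f + 1) = 1 := by rw [← hu]; exact u.inv_mul
    rw [Ideal.mem_bot, mul_assoc, ← this]
    noncomm_ring
  have hmem : ∀ l : List (Module.End A N), (∀ f ∈ l, ¬ Function.Bijective f) →
      l.prod ∈ Ring.jacobson (Module.End A N) ^ l.length := by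
    intro l
    induction l with
    | nil =>
      intro _
      rw [List.length_nil, Submodule.pow_zero]
      exact Submodule.one_le.mp le_rfl
    | cons a l ih =>
      intro h
      rw [List.prod_cons, List.length_cons, Ideal.IsTwoSided.pow_succ]
      exact Ideal.mul_mem_mul (hJ a (h a (by simp))) (ih fun f hf => h f (by simp [hf]))
  refine ⟨n, fun l hl h => ?_⟩
  have := hmem l h
  rw [hl, hn] at this
  simpa using this

/-- The radical of `N` over its endomorphism ring, when that ring is local. -/
def endRadical (A : Type) [Ring A] (N : Type) [AddCommGroup N] [Module A N] : Submodule A N :=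
  ⨆ f : {f : Module.End A N // ¬ Function.Bijective f}, LinearMap.range f.1

theorem range_le_endRadical {f : Module.End A N} (hf : ¬ Function.Bijective f) :
    LinearMap.range f ≤ endRadical A N :=
  le_iSup (fun f : {f : Module.End A N // ¬ Function.Bijective f} => LinearMap.range f.1) ⟨f, hf⟩

/-- Nakayama's lemma for the endomorphism ring of an indecomposable module. -/
theorem Indecomposable.eq_top_of_endRadical_sup
    (K : Type) [Field K] [Algebra K A] [FiniteDimensional K A] [Module.Finite A N]
    (hN : Indecomposable A (ModuleCat.of A N)) (p : Submodule A N)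
    (hp : ∀ f : Module.End A N, p.map f ≤ p) (h : endRadical A N ⊔ p = ⊤) : p = ⊤ := by
  obtain ⟨n, hn⟩ := hN.exists_prod_eq_zero K
  have key : ∀ m ≤ n, ∀ l : List (Module.End A N), l.length = n - m →
      (∀ f ∈ l, ¬ Function.Bijective f) → LinearMap.range l.prod ≤ p := by
    intro m
    induction m with
    | zero =>
      intro _ l hl hf
      rw [hn l (by simpa using hl) hf, LinearMap.range_zero]
      exact bot_le
    | succ m ih =>
      intro hm l hl hf
      rw [LinearMap.range_eq_map, ← h, Submodule.map_sup, sup_le_iff]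
      refine ⟨?_, hp _⟩
      rw [endRadical, Submodule.map_iSup, iSup_le_iff]
      rintro ⟨f, hnf⟩
      rw [← LinearMap.range_comp]
      have := ih (by omega) (l ++ [f]) (by simp; omega) (by
        intro g hg
        rcases List.mem_append.mp hg with hg | hg
        · exact hf g hg
        · rw [List.mem_singleton.mp hg]; exact hnf)
      simpa [Module.End.mul_eq_comp] using this
  have := key n le_rfl [] (by simp) (by simp)
  rw [List.prod_nil, Module.End.one_eq_id, LinearMap.range_id] at this
  exact top_le_iff.mp this

theorem Indecomposable.endRadical_ne_top
    (K : Type) [Field K] [Algebra K A] [FiniteDimensional K A] [Module.Finite A N]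
    (hN : Indecomposable A (ModuleCat.of A N)) : endRadical A N ≠ ⊤ := by
  intro h
  have : Nontrivial N := hN.1
  exact bot_ne_top (hN.eq_top_of_endRadical_sup K ⊥ (by simp) (by simpa using h))

/-- If there is a nonzero map out of `N`, there is one killing the radical of `N`. -/
theorem Indecomposable.exists_ne_zero_endRadical_le_ker
    (K : Type) [Field K] [Algebra K A] [FiniteDimensional K A] [Module.Finite A N]
    (hN : Indecomposable A (ModuleCat.of A N)) {X : Type} [AddCommGroup X] [Module A X]
    (h : N →ₗ[A] X) (hh : h ≠ 0) :
    ∃ h' : N →ₗ[A] X, h' ≠ 0 ∧ endRadical A N ≤ LinearMap.ker h' := by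
  obtain ⟨n, hn⟩ := hN.exists_prod_eq_zero K
  by_contra! hc
  have step : ∀ h' : N →ₗ[A] X, h' ≠ 0 →
      ∃ f : Module.End A N, ¬ Function.Bijective f ∧ h' ∘ₗ f ≠ 0 := by
    intro h' h0
    by_contra! hf
    refine hc h' h0 (iSup_le ?_)
    rintro ⟨f, hnf⟩
    exact LinearMap.range_le_ker_iff.mpr (hf f hnf)
  have key : ∀ m : ℕ, ∃ l : List (Module.End A N), l.length = m ∧
      (∀ f ∈ l, ¬ Function.Bijective f) ∧ h ∘ₗ l.prod ≠ 0 := by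
    intro m
    induction m with
    | zero => exact ⟨[], rfl, by simp, by simpa [Module.End.one_eq_id] using hh⟩
    | succ m ih =>
      obtain ⟨l, hl, hf, h0⟩ := ih
      obtain ⟨f, hnf, hf0⟩ := step _ h0
      refine ⟨l ++ [f], by simp [hl], ?_, ?_⟩
      · intro g hg
        rcases List.mem_append.mp hg with hg | hg
        · exact hf g hg
        · rw [List.mem_singleton.mp hg]; exact hnf
      · simpa [Module.End.mul_eq_comp, LinearMap.comp_assoc] using hf0
  obtain ⟨l, hl, hf, h0⟩ := key n
  exact h0 (by rw [hn l hl hf, LinearMap.comp_zero])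

end Fitting

section Fac

/-- The trace of `M` in `X`: the sum of the images of all maps `M → X`. -/
def traceIn (A : Type) [Ring A] (M X : Type) [AddCommGroup M] [Module A M]
    [AddCommGroup X] [Module A X] : Submodule A X :=
  ⨆ f : M →ₗ[A] X, LinearMap.range f

theorem range_le_traceIn {M X : Type} [AddCommGroup M] [Module A M]
    [AddCommGroup X] [Module A X] (f : M →ₗ[A] X) : LinearMap.range f ≤ traceIn A M X :=
  le_iSup (fun f : M →ₗ[A] X => LinearMap.range f) f

theorem map_traceIn_le {M X Y : Type} [AddCommGroup M] [Module A M]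
    [AddCommGroup X] [Module A X] [AddCommGroup Y] [Module A Y] (g : X →ₗ[A] Y) :
    (traceIn A M X).map g ≤ traceIn A M Y := by
  rw [traceIn, Submodule.map_iSup, iSup_le_iff]
  intro f
  rw [← LinearMap.range_comp]
  exact range_le_traceIn _

theorem traceIn_le_traceIn_of_traceIn_eq_top {L M X : Type} [AddCommGroup L] [Module A L]
    [AddCommGroup M] [Module A M] [AddCommGroup X] [Module A X] (h : traceIn A L M = ⊤) :
    traceIn A M X ≤ traceIn A L X := by
  refine iSup_le fun f => ?_
  rw [LinearMap.range_eq_map, ← h]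
  exact map_traceIn_le f

theorem traceIn_eq_top_of_mem_fac {M X : ModuleCat.{0} A} (h : X ∈ Fac A M) :
    traceIn A M X = ⊤ := by
  obtain ⟨k, f, hf⟩ := h
  rw [eq_top_iff]
  intro x _
  obtain ⟨v, rfl⟩ := hf x
  have hv : v = ∑ i, LinearMap.single A (fun _ : Fin k => M) i (v i) := by
    ext j
    simp [Finset.sum_apply, Pi.single_apply]
  rw [hv, map_sum]
  exact Submodule.sum_mem _ fun i _ => range_le_traceIn (f ∘ₗ LinearMap.single A _ i) ⟨v i, rfl⟩

theorem mem_fac_of_traceIn_eq_top {M X : ModuleCat.{0} A} [Module.Finite A X]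
    (h : traceIn A M X = ⊤) : X ∈ Fac A M := by
  have hc : IsCompactElement (⊤ : Submodule A X) :=
    (Submodule.fg_iff_compact _).mp Module.Finite.fg_top
  obtain ⟨s, hs⟩ := CompleteLattice.IsCompactElement.exists_finset_of_le_iSup
    (Submodule A X) hc (fun f : M →ₗ[A] X => LinearMap.range f) h.ge
  refine ⟨s.card, ∑ i, (s.equivFin.symm i).1 ∘ₗ LinearMap.proj i, ?_⟩
  rw [← LinearMap.range_eq_top, eq_top_iff]
  refine hs.trans (iSup₂_le ?_)
  rintro f hf _ ⟨m, rfl⟩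
  refine ⟨Pi.single (s.equivFin ⟨f, hf⟩) m, ?_⟩
  rw [LinearMap.sum_apply, Finset.sum_eq_single (s.equivFin ⟨f, hf⟩)]
  · simp
  · intro j _ hj
    simp [Pi.single_eq_of_ne hj]
  · simp

theorem finite_of_mem_fac {M X : ModuleCat.{0} A} [Module.Finite A M] (h : X ∈ Fac A M) :
    Module.Finite A X := by
  obtain ⟨k, f, hf⟩ := h
  exact Module.Finite.of_surjective f hf

theorem self_mem_fac (M : ModuleCat.{0} A) : M ∈ Fac A M :=
  ⟨1, LinearMap.proj 0, fun m => ⟨fun _ => m, rfl⟩⟩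

theorem mem_fac_of_surjective {M X Y : ModuleCat.{0} A} (h : X ∈ Fac A M) (g : X →ₗ[A] Y)
    (hg : Function.Surjective g) : Y ∈ Fac A M := by
  obtain ⟨k, f, hf⟩ := h
  exact ⟨k, g ∘ₗ f, hg.comp hf⟩

theorem fac_subset_of_mem {L M : ModuleCat.{0} A} [Module.Finite A M] (h : M ∈ Fac A L) :
    Fac A M ⊆ Fac A L := by
  intro X hX
  have := finite_of_mem_fac hX
  apply mem_fac_of_traceIn_eq_top
  rw [eq_top_iff, ← traceIn_eq_top_of_mem_fac hX]
  exact traceIn_le_traceIn_of_traceIn_eq_top (traceIn_eq_top_of_mem_fac h)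

theorem fac_eq_of_linearEquiv {L M : ModuleCat.{0} A} [Module.Finite A L] (e : L ≃ₗ[A] M) :
    Fac A L = Fac A M := by
  have : Module.Finite A M := Module.Finite.equiv e
  exact (fac_subset_of_mem (mem_fac_of_surjective (self_mem_fac M) e.symm.toLinearMap
    e.symm.surjective)).antisymm (fac_subset_of_mem (mem_fac_of_surjective (self_mem_fac L)
    e.toLinearMap e.surjective))

/-- A map from a τ-rigid module `M` lifts along a surjection with kernel in `Fac M`. -/
theorem IsTauRigid.exists_lift {M : ModuleCat.{0} A} (hM : IsTauRigid A M)
    {L E X : ModuleCat.{0} A} (hL : L ∈ Fac A M) (f : L →ₗ[A] E) (g : E →ₗ[A] X)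
    (hf : Function.Injective f) (hg : Function.Surjective g)
    (hfg : LinearMap.range f = LinearMap.ker g) (h : M →ₗ[A] X) :
    ∃ h' : M →ₗ[A] E, g ∘ₗ h' = h := by
  let P : Submodule A (E × M) :=
    LinearMap.eqLocus (g ∘ₗ LinearMap.fst A E M) (h ∘ₗ LinearMap.snd A E M)
  let f' : L →ₗ[A] P := (LinearMap.inl A E M ∘ₗ f).codRestrict P fun l => by
    have : f l ∈ LinearMap.ker g := hfg ▸ LinearMap.mem_range_self f l
    simpa [P] using this
  let g' : P →ₗ[A] M := LinearMap.snd A E M ∘ₗ P.subtype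
  obtain ⟨s, hs⟩ := hM L hL (ModuleCat.of A P) f' g'
    (fun a b hab => hf (congrArg (fun x : P => x.1.1) hab))
    (fun m => by
      obtain ⟨e, he⟩ := hg (h m)
      exact ⟨⟨(e, m), he⟩, rfl⟩)
    (by
      ext ⟨⟨e, m⟩, hem⟩
      have hem' : g e = h m := hem
      constructor
      · rintro ⟨l, hl⟩
        exact (congrArg (fun x : P => x.1.2) hl).symm
      · intro hm
        have hm0 : m = 0 := hm
        have : e ∈ LinearMap.range f := by
          rw [hfg, LinearMap.mem_ker, hem', hm0, map_zero]
        obtain ⟨l, rfl⟩ := this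
        exact ⟨l, Subtype.ext (Prod.ext rfl hm0.symm)⟩)
  refine ⟨LinearMap.fst A E M ∘ₗ P.subtype ∘ₗ s, LinearMap.ext fun m => ?_⟩
  have h1 : g (s m).1.1 = h (s m).1.2 := (s m).2
  have h2 : (s m).1.2 = m := LinearMap.congr_fun hs m
  exact h1.trans (by rw [h2])

theorem IsTauRigid.isTorsionClass_fac {M : ModuleCat.{0} A} [Module.Finite A M]
    (hM : IsTauRigid A M) : IsTorsionClass A (Fac A M) := by
  refine ⟨fun X hX => finite_of_mem_fac hX,
    fun X hX Y ⟨e⟩ => mem_fac_of_surjective hX e.toLinearMap e.surjective,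
    fun X hX Y ⟨f, hf⟩ => mem_fac_of_surjective hX f hf, ?_⟩
  intro L E N f g hf hg hfg hL hN
  have := finite_of_mem_fac hL
  have := finite_of_mem_fac hN
  have : Module.Finite A E := Module.Finite.of_exact (LinearMap.exact_iff.mpr hfg.symm) hg
  apply mem_fac_of_traceIn_eq_top
  have h1 : LinearMap.ker g ≤ traceIn A M E := by
    rw [← hfg, LinearMap.range_eq_map, ← traceIn_eq_top_of_mem_fac hL]
    exact map_traceIn_le f
  have h2 : (traceIn A M E).map g = ⊤ := by
    rw [eq_top_iff, ← traceIn_eq_top_of_mem_fac hN]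
    refine iSup_le fun h => ?_
    obtain ⟨h', rfl⟩ := hM.exists_lift hL f g hf hg hfg h
    rw [LinearMap.range_comp]
    exact Submodule.map_mono (range_le_traceIn h')
  have h3 := Submodule.comap_map_eq g (traceIn A M E)
  rw [h2, Submodule.comap_top, sup_eq_left.mpr h1] at h3
  exact h3.symm

end Fac

section Torsion

theorem torsGen_subset {T : Set (ModuleCat.{0} A)} (hT : IsTorsionClass A T) {X : ModuleCat.{0} A}
    (hX : X ∈ T) : torsGen A X ⊆ T :=
  Set.sInter_subset_of_mem ⟨hT, hX⟩

theorem self_mem_torsGen (X : ModuleCat.{0} A) : X ∈ torsGen A X :=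
  Set.mem_sInter.mpr fun _ hT => hT.2

theorem isTorsionClass_finite : IsTorsionClass A {X : ModuleCat.{0} A | Module.Finite A X} := by
  refine ⟨fun X hX => hX, fun X (hX : Module.Finite A X) Y ⟨e⟩ => Module.Finite.equiv e,
    fun X (hX : Module.Finite A X) Y ⟨f, hf⟩ => Module.Finite.of_surjective f hf, ?_⟩
  intro L E X f g _ hg hfg (hL : Module.Finite A L) (hX : Module.Finite A X)
  exact Module.Finite.of_exact (LinearMap.exact_iff.mpr hfg.symm) hg

theorem isTorsionClass_torsGen (X : ModuleCat.{0} A) [hX : Module.Finite A X] :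
    IsTorsionClass A (torsGen A X) := by
  refine ⟨fun M hM => torsGen_subset isTorsionClass_finite hX hM,
    fun M hM Y e => Set.mem_sInter.mpr fun T hT => hT.1.2.1 M (hM T hT) Y e,
    fun M hM Y q => Set.mem_sInter.mpr fun T hT => hT.1.2.2.1 M (hM T hT) Y q,
    fun L E Y f g hf hg hfg hL hY => Set.mem_sInter.mpr fun T hT =>
      hT.1.2.2.2 L E Y f g hf hg hfg (hL T hT) (hY T hT)⟩

theorem torsGen_eq_of_linearEquiv {X Y : ModuleCat.{0} A} [Module.Finite A X]
    (e : X ≃ₗ[A] Y) : torsGen A X = torsGen A Y := by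
  have : Module.Finite A Y := Module.Finite.equiv e
  exact (torsGen_subset (isTorsionClass_torsGen Y)
    ((isTorsionClass_torsGen Y).2.1 Y (self_mem_torsGen Y) X ⟨e.symm⟩)).antisymm
    (torsGen_subset (isTorsionClass_torsGen X)
    ((isTorsionClass_torsGen X).2.1 X (self_mem_torsGen X) Y ⟨e⟩))

theorem isTorsionClass_hom_eq_zero (F : ModuleCat.{0} A) :
    IsTorsionClass A {X : ModuleCat.{0} A | Module.Finite A X ∧ ∀ u : X →ₗ[A] F, u = 0} := by
  refine ⟨fun X hX => hX.1, ?_, ?_, ?_⟩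
  · rintro X ⟨hX, h⟩ Y ⟨e⟩
    refine ⟨Module.Finite.equiv e, fun u => ?_⟩
    exact (LinearMap.cancel_right e.surjective).mp ((h (u ∘ₗ e.toLinearMap)).trans
      (LinearMap.zero_comp _).symm)
  · rintro X ⟨hX, h⟩ Y ⟨f, hf⟩
    refine ⟨Module.Finite.of_surjective f hf, fun u => ?_⟩
    exact (LinearMap.cancel_right hf).mp ((h (u ∘ₗ f)).trans (LinearMap.zero_comp _).symm)
  · rintro L E X f g _ hg hfg ⟨hL, hL0⟩ ⟨hX, hX0⟩
    refine ⟨Module.Finite.of_exact (LinearMap.exact_iff.mpr hfg.symm) hg, fun u => ?_⟩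
    have hk : LinearMap.ker g ≤ LinearMap.ker u := by
      rw [← hfg]
      exact LinearMap.range_le_ker_iff.mpr (hL0 _)
    ext x
    have := hX0 ((LinearMap.ker g).liftQ u hk ∘ₗ (g.quotKerEquivOfSurjective hg).symm.toLinearMap)
    have := LinearMap.congr_fun this (g x)
    have hx : (g.quotKerEquivOfSurjective hg).symm (g x) = Submodule.Quotient.mk x := by
      rw [LinearEquiv.symm_apply_eq]; rfl
    simpa [hx] using this

theorem isTorsionClass_zero_or_surjective (S : ModuleCat.{0} A) :
    IsTorsionClass A {X : ModuleCat.{0} A | Module.Finite A X ∧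
      ∀ u : X →ₗ[A] S, u ≠ 0 → Function.Surjective u} := by
  have quot : ∀ X Y : ModuleCat.{0} A, (∀ u : X →ₗ[A] S, u ≠ 0 → Function.Surjective u) →
      ∀ f : X →ₗ[A] Y, Function.Surjective f →
      ∀ u : Y →ₗ[A] S, u ≠ 0 → Function.Surjective u := by
    intro X Y h f hf u hu
    have hs : Function.Surjective (u ∘ₗ f) := h _ fun h0 =>
      hu ((LinearMap.cancel_right hf).mp (h0.trans (LinearMap.zero_comp _).symm))
    rw [LinearMap.coe_comp] at hs
    exact hs.of_comp
  refine ⟨fun X hX => hX.1, ?_, ?_, ?_⟩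
  · rintro X ⟨hX, h⟩ Y ⟨e⟩
    exact ⟨Module.Finite.equiv e, quot X Y h e.toLinearMap e.surjective⟩
  · rintro X ⟨hX, h⟩ Y ⟨f, hf⟩
    exact ⟨Module.Finite.of_surjective f hf, quot X Y h f hf⟩
  · rintro L E X f g _ hg hfg ⟨hL, hL0⟩ ⟨hX, hX0⟩
    refine ⟨Module.Finite.of_exact (LinearMap.exact_iff.mpr hfg.symm) hg, fun u hu => ?_⟩
    by_cases h0 : u ∘ₗ f = 0
    · have hk : LinearMap.ker g ≤ LinearMap.ker u := by
        rw [← hfg]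
        exact LinearMap.range_le_ker_iff.mpr h0
      have hx : ((LinearMap.ker g).liftQ u hk ∘ₗ
          (g.quotKerEquivOfSurjective hg).symm.toLinearMap) ∘ₗ g = u := by
        ext x
        have hx : (g.quotKerEquivOfSurjective hg).symm (g x) = Submodule.Quotient.mk x := by
          rw [LinearEquiv.symm_apply_eq]; rfl
        simp [hx]
      have hs := hX0 ((LinearMap.ker g).liftQ u hk ∘ₗ
        (g.quotKerEquivOfSurjective hg).symm.toLinearMap)
        (fun h => hu (by rw [← hx, h, LinearMap.zero_comp]))
      rw [← hx, LinearMap.coe_comp]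
      exact hs.comp hg
    · have hs := hL0 _ h0
      rw [LinearMap.coe_comp] at hs
      exact hs.of_comp

variable [IsNoetherianRing A]

/-- A module all of whose nonzero quotients receive a nonzero map from a torsion class `T`
lies in `T`. -/
theorem IsTorsionClass.mem_of_forall_quotient {T : Set (ModuleCat.{0} A)}
    (hT : IsTorsionClass A T) (hne : T.Nonempty) {X : ModuleCat.{0} A} [Module.Finite A X]
    (h : ∀ Y : Submodule A X, Y ≠ ⊤ → ∃ L ∈ T, ∃ f : L →ₗ[A] X ⧸ Y, f ≠ 0) : X ∈ T := by
  obtain ⟨L₀, hL₀⟩ := hne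
  obtain ⟨Y, hY, hmax⟩ := (wellFounded_gt (α := Submodule A X)).has_min
    {Y | ModuleCat.of A Y ∈ T}
    ⟨⊥, hT.2.2.1 L₀ hL₀ _ ⟨0, fun y => ⟨0, Subsingleton.elim (α := (⊥ : Submodule A X)) _ _⟩⟩⟩
  by_cases hYt : Y = ⊤
  · refine hT.2.1 _ hY X ⟨?_⟩
    exact LinearEquiv.ofTop Y hYt
  · exfalso
    obtain ⟨L, hL, f, hf⟩ := h Y hYt
    let Z : Submodule A X := (LinearMap.range f).comap Y.mkQ
    have hYZ : Y ≤ Z := fun y hy => by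
      change Y.mkQ y ∈ LinearMap.range f
      rw [Submodule.mkQ_apply, (Submodule.Quotient.mk_eq_zero Y).mpr hy]
      exact zero_mem _
    have hlt : Y < Z := by
      refine lt_of_le_of_ne hYZ fun hEq => hf ?_
      rw [← LinearMap.range_eq_bot, eq_bot_iff]
      intro q hq
      obtain ⟨x, rfl⟩ := Y.mkQ_surjective q
      have : x ∈ Z := hq
      rw [← hEq] at this
      exact (Submodule.Quotient.mk_eq_zero Y).mpr this
    refine hmax Z ?_ hlt
    let g : Z →ₗ[A] LinearMap.range f := (Y.mkQ ∘ₗ Z.subtype).codRestrict _ fun z => z.2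
    refine hT.2.2.2 (ModuleCat.of A Y) (ModuleCat.of A Z) (ModuleCat.of A (LinearMap.range f))
      (Submodule.inclusion hYZ) g (Submodule.inclusion_injective hYZ) ?_ ?_ hY
      (hT.2.2.1 L hL _ ⟨f.rangeRestrict, f.surjective_rangeRestrict⟩)
    · rintro ⟨q, hq⟩
      obtain ⟨x, rfl⟩ := Y.mkQ_surjective q
      exact ⟨⟨x, hq⟩, rfl⟩
    · rw [Submodule.range_inclusion]
      ext ⟨z, hz⟩
      rw [Submodule.mem_comap, LinearMap.mem_ker, ← Submodule.Quotient.mk_eq_zero Y]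
      exact (Subtype.ext_iff (a1 := g ⟨z, hz⟩) (a2 := 0)).symm

theorem IsTorsionClass.fac_subset {T : Set (ModuleCat.{0} A)} (hT : IsTorsionClass A T)
    {M : ModuleCat.{0} A} (hM : M ∈ T) : Fac A M ⊆ T := by
  intro X hX
  have := hT.1 M hM
  have := finite_of_mem_fac hX
  refine hT.mem_of_forall_quotient ⟨M, hM⟩ fun Y hY => ⟨M, hM, ?_⟩
  by_contra! hc
  refine hY (top_le_iff.mp ?_)
  rw [← traceIn_eq_top_of_mem_fac hX]
  refine iSup_le fun f => ?_
  rw [← Y.ker_mkQ]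
  exact LinearMap.range_le_ker_iff.mpr (hc _)

end Torsion

section Correspondence

theorem IsBrick.surjective_of_mem_torsGen {S X : ModuleCat.{0} A}
    [hfin : Module.Finite A S] (hS : IsBrick A S) (hX : X ∈ torsGen A S) (u : X →ₗ[A] S)
    (hu : u ≠ 0) : Function.Surjective u :=
  (torsGen_subset (isTorsionClass_zero_or_surjective S)
    ⟨hfin, fun f hf => (hS.2 f hf).2⟩ hX).2 u hu

theorem exists_ne_zero_of_mem_torsGen {S X : ModuleCat.{0} A}
    [Module.Finite A S] [Nontrivial X] (hX : X ∈ torsGen A S) : ∃ u : S →ₗ[A] X, u ≠ 0 := by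
  by_contra! hc
  have h := (torsGen_subset (isTorsionClass_hom_eq_zero X) ⟨‹_›, hc⟩ hX).2 LinearMap.id
  obtain ⟨x, hx⟩ := exists_ne (0 : X)
  exact hx (LinearMap.congr_fun h x)

/-- Bricks generating the same torsion class are isomorphic. -/
theorem IsBrick.nonempty_linearEquiv_of_torsGen_eq [IsArtinianRing A] {S S' : ModuleCat.{0} A}
    [Module.Finite A S] [Module.Finite A S'] (hS : IsBrick A S) (hS' : IsBrick A S')
    (h : torsGen A S = torsGen A S') : Nonempty (S ≃ₗ[A] S') := by
  have : Nontrivial S := hS.1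
  have : Nontrivial S' := hS'.1
  have hmem : S ∈ torsGen A S' := h ▸ self_mem_torsGen S
  have hmem' : S' ∈ torsGen A S := h ▸ self_mem_torsGen S'
  obtain ⟨u, hu⟩ := exists_ne_zero_of_mem_torsGen hmem'
  obtain ⟨v, hv⟩ := exists_ne_zero_of_mem_torsGen hmem
  have hus := hS'.surjective_of_mem_torsGen hmem u hu
  have hvs := hS.surjective_of_mem_torsGen hmem' v hv
  have hvu : Function.Injective (v ∘ₗ u) :=
    IsNoetherian.injective_of_surjective_endomorphism (v ∘ₗ u) (hvs.comp hus)
  rw [LinearMap.coe_comp] at hvu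
  exact ⟨LinearEquiv.ofBijective u ⟨hvu.of_comp, hus⟩⟩

/-- If an automorphism of the nonzero module `M` factors through the indecomposable module `N`,
then `M` and `N` are isomorphic. -/
theorem Indecomposable.nonempty_linearEquiv_of_bijective_comp {M N : ModuleCat.{0} A}
    [Nontrivial M] (hN : Indecomposable A N) (u : M →ₗ[A] N) (v : N →ₗ[A] M)
    (h : Function.Bijective (v ∘ₗ u)) : Nonempty (M ≃ₗ[A] N) := by
  have hu : Function.Injective u := by
    have := h.1
    rw [LinearMap.coe_comp] at this
    exact this.of_comp
  have hc : IsCompl (LinearMap.range u) (LinearMap.ker v) := by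
    constructor
    · rw [Submodule.disjoint_def]
      rintro _ ⟨m, rfl⟩ hm
      have : m = 0 := h.1 (by simpa using hm)
      rw [this, map_zero]
    · rw [codisjoint_iff, eq_top_iff]
      intro n _
      obtain ⟨m, hm⟩ := h.2 (v n)
      rw [Submodule.mem_sup]
      refine ⟨u m, ⟨m, rfl⟩, n - u m, ?_, by abel⟩
      rw [LinearMap.mem_ker, map_sub, sub_eq_zero]
      exact hm.symm
  rcases hN.2 (ModuleCat.of A (LinearMap.range u)) (ModuleCat.of A (LinearMap.ker v))
    ⟨(Submodule.prodEquivOfIsCompl _ _ hc).symm⟩ with h' | h'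
  · exfalso
    obtain ⟨m, hm⟩ := exists_ne (0 : M)
    have : (⟨u m, m, rfl⟩ : LinearMap.range u) = 0 :=
      @Subsingleton.elim (LinearMap.range u) h' _ _
    exact hm (hu (by simpa using congrArg Subtype.val this))
  · have hk : LinearMap.ker v = ⊥ := Submodule.subsingleton_iff_eq_bot.mp h'
    have hr : LinearMap.range u = ⊤ := by simpa [hk] using hc.sup_eq_top
    exact ⟨LinearEquiv.ofBijective u ⟨hu, LinearMap.range_eq_top.mp hr⟩⟩

/-- Indecomposable modules `M`, `N` with `Fac M = Fac N` are isomorphic. -/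
theorem Indecomposable.nonempty_linearEquiv_of_fac_eq
    (K : Type) [Field K] [Algebra K A] [FiniteDimensional K A] {M N : ModuleCat.{0} A}
    [Module.Finite A M] (hM : Indecomposable A M)
    (hN : Indecomposable A N) (h : Fac A M = Fac A N) : Nonempty (M ≃ₗ[A] N) := by
  have : Nontrivial M := hM.1
  by_contra hc
  refine Indecomposable.endRadical_ne_top (N := M) K hM ?_
  have h1 : traceIn A N M = ⊤ := traceIn_eq_top_of_mem_fac (h ▸ self_mem_fac M)
  have h2 : traceIn A M N = ⊤ := traceIn_eq_top_of_mem_fac (h ▸ self_mem_fac N)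
  rw [eq_top_iff, ← h1]
  refine iSup_le fun v => ?_
  rw [LinearMap.range_eq_map, ← h2, traceIn, Submodule.map_iSup]
  refine iSup_le fun u => ?_
  rw [← LinearMap.range_comp]
  exact range_le_endRadical fun hb => hc (hN.nonempty_linearEquiv_of_bijective_comp u v hb)

/-- The quotient of an indecomposable τ-rigid module by its radical over the endomorphism ring
is a brick generating the torsion class `Fac N`. -/
theorem IsTauRigid.exists_brick
    (K : Type) [Field K] [Algebra K A] [FiniteDimensional K A]
    {N : ModuleCat.{0} A} [Module.Finite A N]
    (hN : Indecomposable A N) (hτ : IsTauRigid A N) :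
    ∃ S : ModuleCat.{0} A, Module.Finite A S ∧ IsBrick A S ∧ Fac A N = torsGen A S := by
  have : IsArtinianRing A := isArtinian_of_tower K inferInstance
  let R : Submodule A N := endRadical A N
  have hR : ModuleCat.of A R ∈ Fac A N := by
    have : Module.Finite A (ModuleCat.of A R) := inferInstanceAs (Module.Finite A R)
    apply mem_fac_of_traceIn_eq_top
    change traceIn A N R = ⊤
    apply Submodule.map_injective_of_injective R.subtype_injective
    rw [Submodule.map_top, Submodule.range_subtype]
    refine le_antisymm (Submodule.map_subtype_le _ _) (iSup_le ?_)
    rintro ⟨f, hf⟩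
    have hfR : ∀ n, f n ∈ R := fun n => range_le_endRadical hf ⟨n, rfl⟩
    rintro _ ⟨n, rfl⟩
    exact ⟨⟨f n, hfR n⟩, range_le_traceIn (f.codRestrict R hfR) ⟨n, rfl⟩, rfl⟩
  let S := ModuleCat.of A (N ⧸ R)
  have hSfin : Module.Finite A S := inferInstanceAs (Module.Finite A (N ⧸ R))
  have hbrick : IsBrick A S := by
    refine ⟨Submodule.Quotient.nontrivial_iff.mpr
      (Indecomposable.endRadical_ne_top (N := N) K hN), fun f hf => ?_⟩
    obtain ⟨g, hg⟩ := hτ.exists_lift (E := N) (X := S) hR R.subtype R.mkQ R.subtype_injective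
      R.mkQ_surjective (by rw [Submodule.range_subtype, Submodule.ker_mkQ]) (f ∘ₗ R.mkQ)
    have hgb : Function.Bijective g := by
      by_contra hgb
      refine hf ((LinearMap.cancel_right R.mkQ_surjective).mp ?_)
      rw [← hg, LinearMap.zero_comp, ← LinearMap.range_le_ker_iff, Submodule.ker_mkQ]
      exact range_le_endRadical hgb
    have hfs : Function.Surjective f := by
      have : Function.Surjective (R.mkQ ∘ₗ g) := R.mkQ_surjective.comp hgb.2
      rw [hg, LinearMap.coe_comp] at this
      exact this.of_comp
    exact IsNoetherian.bijective_of_surjective_endomorphism f hfs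
  refine ⟨S, hSfin, hbrick, ((isTorsionClass_torsGen S).fac_subset ?_).antisymm
    (torsGen_subset hτ.isTorsionClass_fac
      (mem_fac_of_surjective (self_mem_fac N) R.mkQ R.mkQ_surjective))⟩
  refine (isTorsionClass_torsGen S).mem_of_forall_quotient ⟨S, self_mem_torsGen S⟩
    fun Y hY => ⟨S, self_mem_torsGen S, ?_⟩
  obtain ⟨h, h0, hle⟩ := Indecomposable.exists_ne_zero_endRadical_le_ker (N := N) K hN Y.mkQ
    (fun h => hY (by rw [← Y.ker_mkQ, h, LinearMap.ker_zero]))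
  refine ⟨R.liftQ h hle, fun hz => h0 ?_⟩
  rw [← R.liftQ_mkQ h hle]
  exact (congrArg (· ∘ₗ R.mkQ) hz).trans (LinearMap.zero_comp _)

theorem traceIn_prod_le {M N X : Type} [AddCommGroup M] [Module A M] [AddCommGroup N]
    [Module A N] [AddCommGroup X] [Module A X] :
    traceIn A (M × N) X ≤ traceIn A M X ⊔ traceIn A N X := by
  refine iSup_le fun f => ?_
  rintro _ ⟨⟨m, n⟩, rfl⟩
  have : f (m, n) = (f ∘ₗ LinearMap.inl A M N) m + (f ∘ₗ LinearMap.inr A M N) n := by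
    simp [← map_add]
  rw [this]
  exact Submodule.add_mem_sup (range_le_traceIn _ ⟨m, rfl⟩) (range_le_traceIn _ ⟨n, rfl⟩)

/-- In a minimal generator `N ⊕ L` of a torsion class, an indecomposable summand `N` is split
projective. -/
theorem Indecomposable.exists_section_of_not_mem_fac
    (K : Type) [Field K] [Algebra K A] [FiniteDimensional K A]
    {N L E : ModuleCat.{0} A} [Module.Finite A N]
    (hN : Indecomposable A N) (hL : N ∉ Fac A L) (hE : E ∈ Fac A (ModuleCat.of A (N × L)))
    (g : E →ₗ[A] N) (hg : Function.Surjective g) : ∃ s : N →ₗ[A] E, g ∘ₗ s = LinearMap.id := by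
  by_cases hb : ∃ h : N →ₗ[A] E, Function.Bijective (g ∘ₗ h)
  · obtain ⟨h, hb⟩ := hb
    let e := LinearEquiv.ofBijective _ hb
    refine ⟨h ∘ₗ e.symm.toLinearMap, LinearMap.ext fun n => ?_⟩
    exact e.apply_symm_apply n
  · exfalso
    push Not at hb
    refine hL (mem_fac_of_traceIn_eq_top ?_)
    refine Indecomposable.eq_top_of_endRadical_sup (N := N) K hN _ (fun f => map_traceIn_le f) ?_
    rw [eq_top_iff, ← LinearMap.range_eq_top.mpr hg, LinearMap.range_eq_map]
    have ht : traceIn A (N × L) E = ⊤ := traceIn_eq_top_of_mem_fac hE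
    have ht' : traceIn A N E ⊔ traceIn A L E = ⊤ := top_le_iff.mp (ht ▸ traceIn_prod_le)
    rw [← ht', Submodule.map_sup]
    refine sup_le_sup ?_ (map_traceIn_le g)
    rw [traceIn, Submodule.map_iSup]
    refine iSup_le fun h => ?_
    rw [← LinearMap.range_comp]
    exact range_le_endRadical (hb h)

theorem exists_minimal_length {P : ModuleCat.{0} A → Prop} (h : ∃ M, P M) :
    ∃ M, P M ∧ ∀ M', P M' → Module.length A M ≤ Module.length A M' := by
  obtain ⟨M, hM, hmin⟩ := (InvImage.wf (fun M : ModuleCat.{0} A => Module.length A M)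
    (wellFounded_lt (α := ℕ∞))).has_min {M | P M} h
  exact ⟨M, hM, fun M' hM' => not_lt.mp (hmin M' hM')⟩

theorem length_lt_length_prod [IsArtinianRing A] {M N : Type} [AddCommGroup M] [Module A M]
    [AddCommGroup N] [Module A N] [Module.Finite A N] [Nontrivial M] :
    Module.length A N < Module.length A (M × N) := by
  rw [Module.length_prod, add_comm]
  exact (ENat.add_one_le_iff Module.length_ne_top).mp
    (add_le_add_right (Order.one_le_iff_pos.mpr Module.length_pos) _)

theorem IsBrick.exists_tauRigid
    (K : Type) [Field K] [Algebra K A] [FiniteDimensional K A]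
    {S : ModuleCat.{0} A} [Module.Finite A S]
    (hS : IsBrick A S) (hfin : LeftFinite A S) :
    ∃ N : ModuleCat.{0} A, Module.Finite A N ∧ Indecomposable A N ∧ IsTauRigid A N ∧
      Fac A N = torsGen A S := by
  have : IsArtinianRing A := isArtinian_of_tower K inferInstance
  have hT := isTorsionClass_torsGen S
  have : Nontrivial S := hS.1
  obtain ⟨M, ⟨hMfin, hM⟩, hmin⟩ := exists_minimal_length (A := A) hfin
  have hMT : M ∈ torsGen A S := hM ▸ self_mem_fac M
  obtain ⟨u, hu⟩ : ∃ u : M →ₗ[A] S, u ≠ 0 := by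
    by_contra! hc
    have ht := traceIn_eq_top_of_mem_fac (hM ▸ self_mem_torsGen S)
    refine bot_ne_top (α := Submodule A S) (ht ▸ ?_)
    symm
    rw [eq_bot_iff]
    refine iSup_le fun f => ?_
    rw [hc f, LinearMap.range_zero]
  obtain ⟨N, ⟨⟨L, ⟨e⟩⟩, v, hv⟩, hNmin⟩ := exists_minimal_length (A := A)
    (P := fun N => (∃ L : ModuleCat.{0} A, Nonempty (M ≃ₗ[A] (N × L))) ∧
      ∃ v : N →ₗ[A] S, v ≠ 0)
    ⟨M, ⟨ModuleCat.of A PUnit, ⟨(LinearEquiv.prodUnique (R := A) (M := M) (M₂ := PUnit)).symm⟩⟩,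
      u, hu⟩
  have hNLfin : Module.Finite A (N × L) := Module.Finite.equiv e
  have hNfin : Module.Finite A N :=
    Module.Finite.of_surjective (LinearMap.fst A N L) LinearMap.fst_surjective
  have hLfin : Module.Finite A L :=
    Module.Finite.of_surjective (LinearMap.snd A N L) LinearMap.snd_surjective
  have hNnt : Nontrivial N := by
    by_contra h
    rw [not_nontrivial_iff_subsingleton] at h
    exact hv (LinearMap.ext fun x => by rw [Subsingleton.elim x 0, map_zero, map_zero])
  have hNL : Fac A (ModuleCat.of A (N × L)) = torsGen A S :=
    (fac_eq_of_linearEquiv (M := ModuleCat.of A (N × L)) e).symm.trans hM.symm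
  have hNT : N ∈ torsGen A S := hT.2.2.1 M hMT N
    ⟨LinearMap.fst A N L ∘ₗ e.toLinearMap,
      (LinearMap.fst_surjective (R := A) (M := N) (M₂ := L)).comp e.surjective⟩
  have hLT : L ∈ torsGen A S := hT.2.2.1 M hMT L
    ⟨LinearMap.snd A N L ∘ₗ e.toLinearMap,
      (LinearMap.snd_surjective (R := A) (M := N) (M₂ := L)).comp e.surjective⟩
  have hind : Indecomposable A N := by
    refine ⟨hNnt, fun N₁ N₂ ⟨d⟩ => ?_⟩
    have hfinp : Module.Finite A (N₁ × N₂) := Module.Finite.equiv d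
    have hfin₁ : Module.Finite A N₁ :=
      Module.Finite.of_surjective (LinearMap.fst A N₁ N₂) LinearMap.fst_surjective
    have hfin₂ : Module.Finite A N₂ :=
      Module.Finite.of_surjective (LinearMap.snd A N₁ N₂) LinearMap.snd_surjective
    by_contra! hc
    have hnt₁ : Nontrivial N₁ := hc.1
    have hnt₂ : Nontrivial N₂ := hc.2
    let e' : M ≃ₗ[A] ((N₁ × N₂) × L) := e.trans (d.prodCongr (LinearEquiv.refl A L))
    by_cases hv₁ : v ∘ₗ d.symm.toLinearMap ∘ₗ LinearMap.inl A N₁ N₂ = 0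
    · by_cases hv₂ : v ∘ₗ d.symm.toLinearMap ∘ₗ LinearMap.inr A N₁ N₂ = 0
      · refine hv ((LinearMap.cancel_right d.symm.surjective).mp (LinearMap.prod_ext ?_ ?_))
        · exact hv₁
        · exact hv₂
      · have := hNmin N₂ ⟨⟨ModuleCat.of A (N₁ × L), ⟨e'.trans
          (((LinearEquiv.prodComm A N₁ N₂).prodCongr (LinearEquiv.refl A L)).trans
            (LinearEquiv.prodAssoc A N₂ N₁ L))⟩⟩, _, hv₂⟩
        rw [d.length_eq] at this
        exact absurd length_lt_length_prod (not_lt.mpr this)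
    · have := hNmin N₁ ⟨⟨ModuleCat.of A (N₂ × L),
        ⟨e'.trans (LinearEquiv.prodAssoc A N₁ N₂ L)⟩⟩, _, hv₁⟩
      rw [d.length_eq, (LinearEquiv.prodComm A N₁ N₂).length_eq] at this
      exact absurd length_lt_length_prod (not_lt.mpr this)
  have hnot : N ∉ Fac A L := by
    intro hmem
    have hMem : ModuleCat.of A (N × L) ∈ Fac A L := by
      have : Module.Finite A (ModuleCat.of A (N × L)) := hNLfin
      apply mem_fac_of_traceIn_eq_top
      have h1 : LinearMap.range (LinearMap.inl A N L) ≤ traceIn A L (N × L) := by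
        rw [LinearMap.range_eq_map, ← traceIn_eq_top_of_mem_fac hmem]
        exact map_traceIn_le _
      exact top_le_iff.mp (LinearMap.sup_range_inl_inr.ge.trans
        (sup_le h1 (range_le_traceIn (LinearMap.inr A N L))))
    have : Module.Finite A (ModuleCat.of A (N × L)) := hNLfin
    have hle := hmin L ⟨hLfin, (hNL ▸ fac_subset_of_mem hMem).antisymm (hT.fac_subset hLT)⟩
    rw [e.length_eq] at hle
    exact absurd length_lt_length_prod (not_lt.mpr hle)
  have hτ : IsTauRigid A N := by
    intro X hX E f g hf hg hfg
    exact hind.exists_section_of_not_mem_fac K hnot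
      (hNL.symm ▸ hT.2.2.2 X E N f g hf hg hfg (hT.fac_subset hNT hX) hNT) g hg
  refine ⟨N, hNfin, hind, hτ, (hT.fac_subset hNT).antisymm
    (torsGen_subset hτ.isTorsionClass_fac ?_)⟩
  exact mem_fac_of_surjective (self_mem_fac N) v (hS.surjective_of_mem_torsGen hNT v hv)

end Correspondence

end TauRigidBricks

/-- the assignment `N ↦ S`, where `S` is the unique brick with
`Fac N = ⟨S⟩_tors`, induces a bijection from the isomorphism classes of indecomposable
τ-rigid modules onto the isomorphism classes of left finite bricks. -/
theorem brick_tauRigid_correspondence (A : Type) [Ring A]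
    (K : Type) [Field K] [Algebra K A] [FiniteDimensional K A]
 :
    ∃ e : Quotient (isoSetoid A
            (fun M => Module.Finite A M ∧ Indecomposable A M ∧ IsTauRigid A M)) ≃
          Quotient (isoSetoid A
            (fun M => Module.Finite A M ∧ IsBrick A M ∧ LeftFinite A M)),
      ∀ N S, e (Quotient.mk _ N) = Quotient.mk _ S ↔ Fac A N.1 = torsGen A S.1 := by
  have : IsArtinianRing A := isArtinian_of_tower K inferInstance
  let P : ModuleCat.{0} A → Prop :=
    fun M => Module.Finite A M ∧ Indecomposable A M ∧ IsTauRigid A M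
  let Q : ModuleCat.{0} A → Prop :=
    fun M => Module.Finite A M ∧ IsBrick A M ∧ LeftFinite A M
  have hex : ∀ N : {M // P M}, ∃ S : {M // Q M}, Fac A N.1 = torsGen A S.1 := by
    rintro ⟨N, hfin, hind, hτ⟩
    obtain ⟨S, hSfin, hS, h⟩ := hτ.exists_brick K hind
    exact ⟨⟨S, hSfin, hS, N, hfin, h.symm⟩, h⟩
  choose F hF using hex
  have hbrick : ∀ S S' : {M // Q M}, torsGen A S.1 = torsGen A S'.1 →
      Nonempty (S.1 ≃ₗ[A] S'.1) := by
    rintro ⟨S, hfin, hS, _⟩ ⟨S', hfin', hS', _⟩ h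
    exact hS.nonempty_linearEquiv_of_torsGen_eq hS' h
  let e₀ : Quotient (isoSetoid A P) → Quotient (isoSetoid A Q) :=
    Quotient.map F fun N N' ⟨d⟩ => by
      have := N.2.1
      refine hbrick _ _ ?_
      rw [← hF, ← hF]
      exact fac_eq_of_linearEquiv d
  have hspec : ∀ N S, e₀ (Quotient.mk _ N) = Quotient.mk _ S ↔ Fac A N.1 = torsGen A S.1 := by
    intro N S
    rw [hF N]
    refine Quotient.eq.trans ⟨fun ⟨d⟩ => ?_, hbrick _ _⟩
    have := (F N).2.1
    exact torsGen_eq_of_linearEquiv d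
  refine ⟨Equiv.ofBijective e₀ ⟨?_, ?_⟩, hspec⟩
  · intro a b
    induction a using Quotient.ind with | _ N
    induction b using Quotient.ind with | _ N'
    intro h
    have h1 : Fac A N.1 = Fac A N'.1 := ((hspec N (F N')).mp h).trans (hF N').symm
    have := N.2.1
    exact Quotient.sound (N.2.2.1.nonempty_linearEquiv_of_fac_eq K N'.2.2.1 h1)
  · intro b
    induction b using Quotient.ind with | _ S
    have := S.2.1
    obtain ⟨N, hfin, hind, hτ, h⟩ := S.2.2.1.exists_tauRigid K S.2.2.2
    exact ⟨Quotient.mk _ ⟨N, hfin, hind, hτ⟩, (hspec _ S).mpr h⟩
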